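/- The 5-digit Kaprekar map has no fixed point: there is no n with 0 < n < 100000, digits not all equal, such that K(n) = n. -/

import Mathlib

/-- The decimal digits of `n` (little-endian), padded with zeros to length `w`. -/
def padDigits (w n : ℕ) : List ℕ := (Nat.digits 10 n ++ List.replicate w 0).take w

/-- The padded digits of `n` sorted ascending (little-endian), so that
`Nat.ofDigits 10 (sortedDigits w n)` is the descending arrangement `X` and
`Nat.ofDigits 10 (sortedDigits w n).reverse` is the ascending arrangement `Y`. -/
def sortedDigits (w n : ℕ) : List ℕ := (padDigits w n).mergeSort (· ≤ ·)

/-- The Kaprekar map on `w`-digit numbers: descending arrangement minus ascending arrangement. -/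
def kap (w n : ℕ) : ℕ :=
  Nat.ofDigits 10 (sortedDigits w n) - Nat.ofDigits 10 (sortedDigits w n).reverse

/-- All `w` (padded) digits of `n` are equal. -/
def allEqDigits (w n : ℕ) : Prop := ∃ d, padDigits w n = List.replicate w d

theorem length_padDigits (w n : ℕ) : (padDigits w n).length = w := by
  simp [padDigits]

theorem ofDigits_sub_ofDigits_reverse {a b c d e : ℕ} (hab : a ≤ b) (hbd : b ≤ d) (hde : d ≤ e) :
    Nat.ofDigits 10 [a, b, c, d, e] - Nat.ofDigits 10 [a, b, c, d, e].reverse =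
      9999 * (e - a) + 990 * (d - b) := by
  simp only [List.reverse_cons, List.reverse_nil, List.nil_append, List.cons_append,
    Nat.ofDigits_cons, Nat.ofDigits_nil]
  omega

/-- With `x` and `y` the differences of the outer and the inner pair of sorted digits,
the five-digit Kaprekar map takes the value `9999 * x + 990 * y`. -/
theorem exists_kap_five_eq (n : ℕ) : ∃ x y, y ≤ x ∧ kap 5 n = 9999 * x + 990 * y := by
  have hlen : (sortedDigits 5 n).length = 5 := by
    rw [sortedDigits, List.length_mergeSort, length_padDigits]
  have hsorted : (sortedDigits 5 n).Pairwise (· ≤ ·) := List.pairwise_mergeSort' _ _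
  unfold kap
  generalize sortedDigits 5 n = l at hlen hsorted
  match l, hlen with
  | [a, b, c, d, e], _ =>
    simp only [List.pairwise_cons, List.mem_cons, List.not_mem_nil, or_false,
      forall_eq_or_imp, forall_eq] at hsorted
    exact ⟨e - a, d - b, by omega, ofDigits_sub_ofDigits_reverse (by omega) (by omega) (by omega)⟩

theorem kap_five_ne :
    ∀ x < 11, ∀ y < x + 1, 0 < x → kap 5 (9999 * x + 990 * y) ≠ 9999 * x + 990 * y := by
  simp only [kap, sortedDigits, List.mergeSort_eq_insertionSort]
  decide +kernel

theorem stmt16 :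
    ¬ ∃ n : ℕ, 0 < n ∧ n < 100000 ∧ ¬ allEqDigits 5 n ∧ kap 5 n = n := by
  rintro ⟨n, hpos, hlt, -, hfix⟩
  obtain ⟨x, y, hyx, hxy⟩ := exists_kap_five_eq n
  obtain rfl : n = 9999 * x + 990 * y := hfix.symm.trans hxy
  exact kap_five_ne x (by omega) y (by omega) (by omega) hfix
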